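/- Let X be a finite set with decidable equality and let R ⊆ F(X) be a finite symmetrized set of relators satisfying C''(4) and T(4), with presented group G = ⟨X | R⟩. Then the word problem for G is decidable: there exists a computable function f from words over X to Bool such that f(w) = true if and only if w represents the identity element of G. -/

import Mathlib

/-- A *word* over `X` is a finite sequence of letters, where a letter is a generator
`x : X` together with a sign (`true` for `x`, `false` for `x⁻¹`). -/
abbrev Word (X : Type*) := List (X × Bool)

/-- The formal inverse of a letter. -/
def letterInv {X : Type*} (l : X × Bool) : X × Bool := (l.1, !l.2)

/-- The element of the presented group `⟨X | R⟩` represented by a word. -/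
def toG {X : Type*} (R : Set (FreeGroup X)) (w : Word X) : PresentedGroup R :=
  PresentedGroup.mk R (FreeGroup.mk w)

/-- A word is freely reduced if it has no two adjacent mutually inverse letters. -/
def FreelyReduced {X : Type*} (w : Word X) : Prop :=
  w.Chain' fun l₁ l₂ => l₂ ≠ letterInv l₁

/-- A nonempty word `p` is a piece w.r.t. `R` if two distinct relators of `R` both start
with `p` (as reduced words, i.e. products without cancellation). -/
def IsPiece {X : Type*} [DecidableEq X] (R : Set (FreeGroup X)) (p : Word X) : Prop :=
  p ≠ [] ∧ ∃ r ∈ R, ∃ s ∈ R, r ≠ s ∧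
    (∃ u, FreeGroup.toWord r = p ++ u) ∧ (∃ v, FreeGroup.toWord s = p ++ v)

/-- A (reduced) word is cyclically reduced if its last letter is not the inverse
of its first letter. -/
def CyclicallyReducedWord {X : Type*} (w : Word X) : Prop :=
  FreelyReduced w ∧ ¬ ∃ (a : X × Bool) (t : Word X), w = a :: (t ++ [letterInv a])

/-- `R` is symmetrized: every relator is cyclically reduced and `R` is closed under
inversion and under cyclic permutation of reduced words. -/
def Symmetrized {X : Type*} [DecidableEq X] (R : Set (FreeGroup X)) : Prop :=
  (∀ r ∈ R, CyclicallyReducedWord (FreeGroup.toWord r)) ∧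
  (∀ r ∈ R, r⁻¹ ∈ R) ∧
  (∀ r ∈ R, ∀ (a : X × Bool) (t : Word X),
      FreeGroup.toWord r = a :: t → FreeGroup.mk (t ++ [a]) ∈ R)

/-- The C''(4) condition: all relators have length four, and no relator is a product
(without cancellation) of fewer than four pieces. -/
def Cpp4 {X : Type*} [DecidableEq X] (R : Set (FreeGroup X)) : Prop :=
  (∀ r ∈ R, (FreeGroup.toWord r).length = 4) ∧
  (∀ r ∈ R, ¬ ∃ ps : List (Word X), ps.length < 4 ∧ (∀ p ∈ ps, IsPiece R p) ∧
      FreeGroup.toWord r = ps.flatten)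

/-- The product `r * s` is reduced without cancellation. -/
def NoCancel {X : Type*} [DecidableEq X] (r s : FreeGroup X) : Prop :=
  FreeGroup.toWord (r * s) = FreeGroup.toWord r ++ FreeGroup.toWord s

/-- The T(4) condition. -/
def T4 {X : Type*} [DecidableEq X] (R : Set (FreeGroup X)) : Prop :=
  ∀ r₁ ∈ R, ∀ r₂ ∈ R, ∀ r₃ ∈ R,
    r₁ ≠ r₂⁻¹ → r₂ ≠ r₃⁻¹ → r₁ ≠ r₃⁻¹ →
    NoCancel r₁ r₂ ∨ NoCancel r₂ r₃ ∨ NoCancel r₃ r₁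

/-- The word `a t₁⋯tₙ b` is a chain word with inner link path `s₁⋯sₙ` (n ≥ 1):
there are letters `u₀, …, uₙ` with `u₀ = a⁻¹`, `uₙ = b` and `tᵢ uᵢ sᵢ⁻¹ u_{i-1}⁻¹ ∈ R`
for all `i`. -/
def IsChainWord {X : Type*} (R : Set (FreeGroup X))
    (a : X × Bool) (t s : Word X) (b : X × Bool) : Prop :=
  1 ≤ t.length ∧ ∃ hlen : t.length = s.length, ∃ u : ℕ → X × Bool,
    u 0 = letterInv a ∧ u t.length = b ∧
    ∀ i, ∀ hi : i < t.length,
      FreeGroup.mk [t[i], u (i + 1), letterInv (s[i]'(hlen ▸ hi)), letterInv (u i)] ∈ R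

/-- A word is geodesic if no strictly shorter word represents the same element of the
presented group. -/
def Geodesic {X : Type*} (R : Set (FreeGroup X)) (w : Word X) : Prop :=
  ∀ v : Word X, toG R v = toG R w → w.length ≤ v.length

/-- A word is cyclically geodesic if all of its cyclic permutations are geodesic. -/
def CyclicallyGeodesic {X : Type*} (R : Set (FreeGroup X)) (w : Word X) : Prop :=
  ∀ n : ℕ, Geodesic R (w.rotate n)

/-- A pair is a two-letter contiguous subword of (the reduced word of) a relator of `R`. -/
def IsPair {X : Type*} [DecidableEq X] (R : Set (FreeGroup X)) (l₁ l₂ : X × Bool) : Prop :=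
  ∃ r ∈ R, [l₁, l₂] <:+: FreeGroup.toWord r

/-- `P` holds for all cyclically-consecutive entries of `w`. -/
def CyclicAdj {X : Type*} (P : (X × Bool) → (X × Bool) → Prop) (w : Word X) : Prop :=
  ∀ i, ∀ hi : i < w.length,
    P (w[i]) (w[(i + 1) % w.length]'(Nat.mod_lt _ (by omega)))

/-- The presentation has parity with respect to `par : X → Bool` (`true` = white,
`false` = black) if in every relator, read cyclically, consecutive letters have
opposite parities. -/
def HasParity {X : Type*} [DecidableEq X] (R : Set (FreeGroup X)) (par : X → Bool) : Prop :=
  ∀ r ∈ R, CyclicAdj (fun l₁ l₂ => par l₁.1 ≠ par l₂.1) (FreeGroup.toWord r)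

/-- The presentation is alternating: in every relator, read cyclically, letters of
exponent `+1` and exponent `-1` alternate. -/
def AlternatingPresentation {X : Type*} [DecidableEq X] (R : Set (FreeGroup X)) : Prop :=
  ∀ r ∈ R, CyclicAdj (fun l₁ l₂ => l₁.2 ≠ l₂.2) (FreeGroup.toWord r)

/-- A word alternates in sign if adjacent letters have opposite exponents. -/
def AlternatesInSign {X : Type*} (w : Word X) : Prop :=
  w.Chain' fun l₁ l₂ => l₁.2 ≠ l₂.2

/-- A pair exchange: if `x₁x₂x₃x₄ ∈ R`, replace an occurrence of the contiguous subword
`x₁x₂` by `x₄⁻¹x₃⁻¹`. -/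
def PairExchange {X : Type*} (R : Set (FreeGroup X)) (v w : Word X) : Prop :=
  ∃ (p q : Word X) (x₁ x₂ x₃ x₄ : X × Bool),
    FreeGroup.mk [x₁, x₂, x₃, x₄] ∈ R ∧
    v = p ++ [x₁, x₂] ++ q ∧ w = p ++ [letterInv x₄, letterInv x₃] ++ q

/-- A free reduction deletes an adjacent mutually inverse pair of letters. -/
def FreeReductionStep {X : Type*} (v w : Word X) : Prop :=
  ∃ (p q : Word X) (l : X × Bool), v = p ++ [l, letterInv l] ++ q ∧ w = p ++ q

/-- A chain collapse replaces a contiguous chain word subword by its inner link path. -/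
def ChainCollapseStep {X : Type*} (R : Set (FreeGroup X)) (v w : Word X) : Prop :=
  ∃ (p q : Word X) (a b : X × Bool) (t s : Word X),
    IsChainWord R a t s b ∧ v = p ++ (a :: (t ++ [b])) ++ q ∧ w = p ++ s ++ q

/-- A chain flip replaces one side of a conjugacy chain by the other: it replaces the
whole word `s₁⋯sₙ` by `t₁⋯tₙ` (or vice versa) where, for some letter `a`, the word
`a t₁⋯tₙ a⁻¹` is a chain word with inner link path `s₁⋯sₙ`. -/
def ChainFlip {X : Type*} (R : Set (FreeGroup X)) (v w : Word X) : Prop :=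
  ∃ a : X × Bool, IsChainWord R a w v (letterInv a) ∨ IsChainWord R a v w (letterInv a)

theorem letterInv_letterInv {X : Type*} (l : X × Bool) : letterInv (letterInv l) = l := by
  simp [letterInv]

theorem letterInv_injective {X : Type*} : Function.Injective (letterInv : X × Bool → X × Bool) :=
  Function.LeftInverse.injective letterInv_letterInv

theorem letterInv_ne {X : Type*} (l : X × Bool) : letterInv l ≠ l := by
  simp [letterInv, Prod.ext_iff]

theorem eq_or_eq_letterInv {X : Type*} {k l : X × Bool} (h : k.1 = l.1) :
    k = l ∨ k = letterInv l := by
  obtain ⟨x, _ | _⟩ := k <;> obtain ⟨y, _ | _⟩ := l <;> simp_all [letterInv]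

/-- The combinatorics of a simply connected square complex with one label per oriented edge:
`S x a y b` says that the paths `x a` and `y b` bound a square. Vertex links are simple
triangle-free graphs. -/
structure SquareSystem {X : Type*} (S : X × Bool → X × Bool → X × Bool → X × Bool → Prop) :
    Prop where
  symm : ∀ {x a y b}, S x a y b → S y b x a
  turn : ∀ {x a y b}, S x a y b → S (letterInv x) y a (letterInv b)
  ne : ∀ {x a y b}, S x a y b → x ≠ y
  triangle : ∀ {x a y b z c d e f}, S x a y b → S y c z d → S z e x f → False
  unique : ∀ {x a y b y' b'}, S x a y b → S x a y' b' → y = y' ∧ b = b'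

namespace SquareSystem

variable {X : Type*} {S : X × Bool → X × Bool → X × Bool → X × Bool → Prop}

theorem flip (h : SquareSystem S) {x a y b} (hs : S x a y b) :
    S (letterInv a) (letterInv x) (letterInv b) (letterInv y) :=
  h.turn (h.symm (h.turn hs))

theorem end_ne (h : SquareSystem S) {x a y b} (hs : S x a y b) : a ≠ b := fun e =>
  h.ne (h.flip hs) (congrArg letterInv e)

theorem corner_unique (h : SquareSystem S) {x a y b a' b'} (hs : S x a y b)
    (hs' : S x a' y b') : a = a' ∧ b = b' := by
  obtain ⟨h1, h2⟩ := h.unique (h.turn hs) (h.turn hs')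
  exact ⟨h1, letterInv_injective h2⟩

theorem end_corner_unique (h : SquareSystem S) {x a y b x' y'} (hs : S x a y b)
    (hs' : S x' a y' b) : x = x' ∧ y = y' := by
  obtain ⟨h1, h2⟩ := h.corner_unique (h.flip hs) (h.flip hs')
  exact ⟨letterInv_injective h1, letterInv_injective h2⟩

/-- Words are stored with the last letter first. `Desc S s y` says that `y` is a descent of `s`:
multiplying `s` by `y` on the right shortens it. -/
def Desc (S : X × Bool → X × Bool → X × Bool → X × Bool → Prop) : Word X → X × Bool → Prop
  | [], _ => False
  | z :: p, y => y = letterInv z ∨ ∃ x b, Desc S p x ∧ S z y x b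

/-- A word is geodesic for `S` when each letter is not a descent of what precedes it. -/
def Reduced (S : X × Bool → X × Bool → X × Bool → X × Bool → Prop) : Word X → Prop
  | [] => True
  | z :: p => Reduced S p ∧ ¬ Desc S p z

/-- Crossing one square inside a word. -/
inductive Cross (S : X × Bool → X × Bool → X × Bool → X × Bool → Prop) :
    Word X → Word X → Prop
  | head {x a y b} (p : Word X) : S x a y b → Cross S (a :: x :: p) (b :: y :: p)
  | cons (z : X × Bool) {p q : Word X} : Cross S p q → Cross S (z :: p) (z :: q)

/-- Homotopy of words of constant length. -/
abbrev Homotopic (S : X × Bool → X × Bool → X × Bool → X × Bool → Prop) :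
    Word X → Word X → Prop :=
  Relation.ReflTransGen (Cross S)

theorem Cross.symm (h : SquareSystem S) {s t : Word X} (hc : Cross S s t) : Cross S t s := by
  induction hc with
  | head p hs => exact .head p (h.symm hs)
  | cons z _ ih => exact .cons z ih

theorem Homotopic.symm (h : SquareSystem S) {s t : Word X} (hc : Homotopic S s t) :
    Homotopic S t s := by
  induction hc with
  | refl => exact .refl
  | tail _ hc ih => exact .head (hc.symm h) ih

theorem Homotopic.cons (z : X × Bool) {s t : Word X} (hc : Homotopic S s t) :
    Homotopic S (z :: s) (z :: t) := by
  induction hc with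
  | refl => exact .refl
  | tail _ hc ih => exact .tail ih (.cons z hc)

theorem Cross.length_eq {s t : Word X} (hc : Cross S s t) : s.length = t.length := by
  induction hc with
  | head p hs => simp
  | cons z _ ih => simp [ih]

theorem Homotopic.length_eq {s t : Word X} (hc : Homotopic S s t) : s.length = t.length := by
  induction hc with
  | refl => rfl
  | tail _ hc ih => rw [ih, hc.length_eq]

theorem desc_cons_cons (h : SquareSystem S) {x a y b : X × Bool} (hs : S x a y b) (p : Word X)
    (l : X × Bool) : Desc S (a :: x :: p) l ↔ l = letterInv a ∨ l = letterInv b := by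
  constructor
  · rintro (rfl | ⟨u, c, hu, huc⟩)
    · exact .inl rfl
    rcases hu with rfl | ⟨v, d, hv, hvd⟩
    · exact .inr (h.corner_unique huc (h.symm (h.turn hs))).1
    · exact (h.triangle (h.turn hvd) (h.symm huc) (h.symm (h.turn hs))).elim
  · rintro (rfl | rfl)
    · exact .inl rfl
    · exact .inr ⟨letterInv x, y, .inl rfl, h.symm (h.turn hs)⟩

theorem reduced_cons_cons (h : SquareSystem S) {x a y b : X × Bool} (hs : S x a y b)
    (p : Word X) :
    Reduced S (a :: x :: p) ↔ Reduced S p ∧ ¬ Desc S p x ∧ ¬ Desc S p y := by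
  have key : Desc S (x :: p) a ↔ Desc S p y := by
    constructor
    · rintro (rfl | ⟨u, c, hu, huc⟩)
      · exact (h.ne (h.turn hs) rfl).elim
      · rwa [(h.unique hs huc).1]
    · exact fun hy => .inr ⟨y, b, hy, hs⟩
  simp only [Reduced, key, and_assoc]

theorem Cross.desc_iff (h : SquareSystem S) {s t : Word X} (hc : Cross S s t) (l : X × Bool) :
    Desc S s l ↔ Desc S t l := by
  induction hc generalizing l with
  | head p hs => rw [h.desc_cons_cons hs, h.desc_cons_cons (h.symm hs), or_comm]
  | cons z _ ih => simp only [Desc, ih]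

theorem Cross.reduced (h : SquareSystem S) {s t : Word X} (hc : Cross S s t)
    (hr : Reduced S s) : Reduced S t := by
  induction hc with
  | head p hs =>
    rw [h.reduced_cons_cons hs] at hr
    rw [h.reduced_cons_cons (h.symm hs)]
    exact ⟨hr.1, hr.2.2, hr.2.1⟩
  | cons z hc ih => exact ⟨ih hr.1, fun hd => hr.2 ((hc.desc_iff h z).2 hd)⟩

theorem Homotopic.desc_iff (h : SquareSystem S) {s t : Word X} (hc : Homotopic S s t)
    (l : X × Bool) : Desc S s l ↔ Desc S t l := by
  induction hc with
  | refl => rfl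
  | tail _ hc ih => rw [ih, hc.desc_iff h]

theorem Homotopic.reduced (h : SquareSystem S) {s t : Word X} (hc : Homotopic S s t)
    (hr : Reduced S s) : Reduced S t := by
  induction hc with
  | refl => exact hr
  | tail _ hc ih => exact hc.reduced h ih

theorem Homotopic.cons_cases (h : SquareSystem S) {u v : X × Bool} {p p' : Word X}
    (hc : Homotopic S (u :: p) (v :: p')) :
    (u = v ∧ Homotopic S p p') ∨
      ∃ q a b, Homotopic S p (a :: q) ∧ Homotopic S p' (b :: q) ∧ S a u b v := by
  induction hn : p.length using Nat.strong_induction_on generalizing u v p p' with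
  | _ n IH =>
  generalize ht : v :: p' = t at hc
  induction hc generalizing v p' with
  | refl =>
    obtain ⟨rfl, rfl⟩ := List.cons.inj ht
    exact .inl ⟨rfl, .refl⟩
  | @tail t₀ t hst hc ih =>
    subst ht
    cases hc with
    | @head y b _ _ r hs =>
      rename_i c
      rcases ih rfl with ⟨rfl, hp⟩ | ⟨q, a', b', hp, hp', hs'⟩
      · exact .inr ⟨r, y, c, hp, .refl, hs⟩
      by_cases huv : u = v
      · subst huv
        obtain ⟨rfl, rfl⟩ := h.end_corner_unique hs' (h.symm hs)
        refine .inl ⟨rfl, ?_⟩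
        have hlen : q.length < n := by
          have := hp.length_eq
          simp only [List.length_cons] at this
          omega
        rcases IH _ hlen (hp'.symm h) rfl with ⟨-, hq⟩ | ⟨_, _, _, -, -, hq⟩
        · exact hp.trans (hq.cons a')
        · exact (h.end_ne hq rfl).elim
      · have hu : Desc S (b :: y :: r) (letterInv u) := (Homotopic.desc_iff h hst _).1 (.inl rfl)
        rcases (h.desc_cons_cons hs r _).1 hu with e | e
        · exact (h.ne (h.flip hs') e).elim
        · exact (huv (letterInv_injective e)).elim
    | @cons _ p₀ _ hc =>
      rcases ih rfl with ⟨rfl, hp⟩ | ⟨q, a, b, hp, hp', hs⟩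
      · exact .inl ⟨rfl, hp.tail hc⟩
      · exact .inr ⟨q, a, b, hp, .head (hc.symm h) hp', hs⟩

theorem Homotopic.of_cons (h : SquareSystem S) {u : X × Bool} {p p' : Word X}
    (hc : Homotopic S (u :: p) (u :: p')) : Homotopic S p p' := by
  rcases hc.cons_cases h with ⟨-, hp⟩ | ⟨_, _, _, -, -, hs⟩
  · exact hp
  · exact (h.end_ne hs rfl).elim

/-- `t` represents the product of `s` by the letter `y`. -/
def IsMul (S : X × Bool → X × Bool → X × Bool → X × Bool → Prop) (s : Word X) (y : X × Bool)
    (t : Word X) : Prop :=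
  (¬ Desc S s y ∧ Homotopic S t (y :: s)) ∨ (Desc S s y ∧ Homotopic S s (letterInv y :: t))

theorem IsMul.congr (h : SquareSystem S) {s s' t t' : Word X} {y : X × Bool}
    (hm : IsMul S s y t) (hm' : IsMul S s' y t') (hs : Homotopic S s s') :
    Homotopic S t t' := by
  rcases hm with ⟨hd, ht⟩ | ⟨hd, ht⟩ <;> rcases hm' with ⟨hd', ht'⟩ | ⟨hd', ht'⟩
  · exact (ht.trans (hs.cons y)).trans (ht'.symm h)
  · exact (hd ((hs.desc_iff h y).2 hd')).elim
  · exact (hd' ((hs.desc_iff h y).1 hd)).elim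
  · exact Homotopic.of_cons h (((ht.symm h).trans hs).trans ht')

theorem IsMul.reduced (h : SquareSystem S) {s t : Word X} {y : X × Bool}
    (hm : IsMul S s y t) (hr : Reduced S s) : Reduced S t := by
  rcases hm with ⟨hd, ht⟩ | ⟨hd, ht⟩
  · exact (ht.symm h).reduced h ⟨hr, hd⟩
  · exact (ht.reduced h hr).1

theorem IsMul.symm (h : SquareSystem S) {s t : Word X} {y : X × Bool}
    (hm : IsMul S s y t) (hr : Reduced S s) : IsMul S t (letterInv y) s := by
  rcases hm with ⟨hd, ht⟩ | ⟨hd, ht⟩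
  · exact .inr ⟨(ht.desc_iff h _).2 (.inl rfl), by rwa [letterInv_letterInv]⟩
  · exact .inl ⟨(ht.reduced h hr).2, ht⟩

theorem exists_homotopic_cons (h : SquareSystem S) {s : Word X} {y : X × Bool}
    (hd : Desc S s y) : ∃ t, Homotopic S s (letterInv y :: t) := by
  induction s generalizing y with
  | nil => exact hd.elim
  | cons z p ih =>
    rcases hd with rfl | ⟨x, b, hx, hs⟩
    · exact ⟨p, by rw [letterInv_letterInv]⟩
    · obtain ⟨q, hq⟩ := ih hx
      exact ⟨b :: q, (hq.cons z).tail (.head q (h.turn (h.symm hs)))⟩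

theorem isMul_square_of_desc (h : SquareSystem S) {s : Word X} {a b e f : X × Bool}
    (hs : S a b e f) (ha : Desc S s a) :
    ∃ t t' v, IsMul S s a t ∧ IsMul S t b v ∧ IsMul S s e t' ∧ IsMul S t' f v := by
  obtain ⟨t, ht⟩ := h.exists_homotopic_cons ha
  have key : Desc S s e ↔ Desc S t b := by
    rw [ht.desc_iff h]
    constructor
    · rintro (rfl | ⟨x, c, hx, hxc⟩)
      · exact (h.ne hs (letterInv_letterInv a).symm).elim
      · rwa [← (h.unique hxc (h.turn hs)).1]
    · exact fun hb => .inr ⟨b, _, hb, h.turn hs⟩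
  by_cases he : Desc S s e
  · obtain ⟨v, hv⟩ := h.exists_homotopic_cons (key.1 he)
    have hse : Homotopic S s (letterInv e :: letterInv f :: v) :=
      (ht.trans (hv.cons _)).tail (.head v (h.flip hs))
    refine ⟨t, letterInv f :: v, v, .inr ⟨ha, ht⟩, .inr ⟨key.1 he, hv⟩, .inr ⟨he, hse⟩,
      .inr ⟨.inl (letterInv_letterInv f).symm, .refl⟩⟩
  · refine ⟨t, e :: s, b :: t, .inr ⟨ha, ht⟩, .inl ⟨mt key.2 he, .refl⟩, .inl ⟨he, .refl⟩,
      .inr ⟨.inr ⟨a, b, ha, h.symm hs⟩, ?_⟩⟩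
    exact (ht.cons e).tail (.head t (h.turn hs))

theorem isMul_square (h : SquareSystem S) (s : Word X) {a b e f : X × Bool} (hs : S a b e f) :
    ∃ t t' v, IsMul S s a t ∧ IsMul S t b v ∧ IsMul S s e t' ∧ IsMul S t' f v := by
  by_cases ha : Desc S s a
  · exact h.isMul_square_of_desc hs ha
  by_cases he : Desc S s e
  · obtain ⟨t, t', v, h1, h2, h3, h4⟩ := h.isMul_square_of_desc (h.symm hs) he
    exact ⟨t', t, v, h3, h4, h1, h2⟩
  refine ⟨a :: s, e :: s, b :: a :: s, .inl ⟨ha, .refl⟩, .inl ⟨?_, .refl⟩, .inl ⟨he, .refl⟩,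
    .inl ⟨?_, .single (.head s hs)⟩⟩
  · rintro (rfl | ⟨x, c, hx, hxc⟩)
    · exact h.ne (h.turn hs) rfl
    · exact he (by rwa [(h.unique hs hxc).1])
  · rintro (rfl | ⟨x, c, hx, hxc⟩)
    · exact h.ne (h.turn (h.symm hs)) rfl
    · exact ha (by rwa [(h.unique (h.symm hs) hxc).1])

open Classical in
/-- The two other sides `(x, b)` of the square containing the path `z y`, if there is one. -/
noncomputable def opposite (S : X × Bool → X × Bool → X × Bool → X × Bool → Prop)
    (z y : X × Bool) : Option ((X × Bool) × (X × Bool)) :=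
  if hp : ∃ p : (X × Bool) × (X × Bool), S z y p.1 p.2 then some hp.choose else none

theorem opposite_eq_some_iff (h : SquareSystem S) {z y : X × Bool}
    {p : (X × Bool) × (X × Bool)} : opposite S z y = some p ↔ S z y p.1 p.2 := by
  unfold opposite
  split_ifs with hp
  · rw [Option.some.injEq]
    refine ⟨fun e => e ▸ hp.choose_spec, fun hs => ?_⟩
    obtain ⟨h1, h2⟩ := h.unique hp.choose_spec hs
    exact Prod.ext h1 h2
  · simp only [false_iff]
    exact fun hs => hp ⟨p, hs⟩

/-- Cancel the descent `y` at the end of a word, by pushing it through squares. -/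
noncomputable def cancel [DecidableEq X]
    (S : X × Bool → X × Bool → X × Bool → X × Bool → Prop) :
    Word X → X × Bool → Option (Word X)
  | [], _ => none
  | z :: p, y => if y = letterInv z then some p else
      (opposite S z y).bind fun q => (cancel S p q.1).map (q.2 :: ·)

/-- Multiply a word by a letter on the right. -/
noncomputable def mul [DecidableEq X]
    (S : X × Bool → X × Bool → X × Bool → X × Bool → Prop) (s : Word X) (y : X × Bool) :
    Word X :=
  (cancel S s y).getD (y :: s)

theorem cancel_eq_some [DecidableEq X] (h : SquareSystem S) {s t : Word X} {y : X × Bool}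
    (hc : cancel S s y = some t) : Desc S s y ∧ Homotopic S s (letterInv y :: t) := by
  induction s generalizing y t with
  | nil => simp [cancel] at hc
  | cons z p ih =>
    rw [cancel] at hc
    split_ifs at hc with hy
    · obtain rfl := Option.some.inj hc
      subst hy
      exact ⟨.inl rfl, by rw [letterInv_letterInv]⟩
    · obtain ⟨⟨x, b⟩, hq, hc⟩ := Option.bind_eq_some_iff.1 hc
      obtain ⟨q, hcq, rfl⟩ := Option.map_eq_some_iff.1 hc
      have hs : S z y x b := h.opposite_eq_some_iff.1 hq
      obtain ⟨hd, hp⟩ := ih hcq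
      exact ⟨.inr ⟨x, b, hd, hs⟩, (hp.cons z).tail (.head q (h.turn (h.symm hs)))⟩

theorem cancel_ne_none [DecidableEq X] (h : SquareSystem S) {s : Word X} {y : X × Bool}
    (hd : Desc S s y) : cancel S s y ≠ none := by
  induction s generalizing y with
  | nil => exact hd.elim
  | cons z p ih =>
    rw [cancel]
    split_ifs with hy
    · simp
    · obtain ⟨x, b, hx, hs⟩ := hd.resolve_left hy
      have ho : opposite S z y = some (x, b) := h.opposite_eq_some_iff.2 hs
      rw [ho, Option.bind_some, ne_eq, Option.map_eq_none_iff]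
      exact ih hx

theorem isMul_mul [DecidableEq X] (h : SquareSystem S) (s : Word X) (y : X × Bool) :
    IsMul S s y (mul S s y) := by
  unfold mul
  cases hc : cancel S s y with
  | none => exact .inl ⟨fun hd => h.cancel_ne_none hd hc, .refl⟩
  | some t => exact .inr (h.cancel_eq_some hc)

/-- Reduced words up to homotopy: the vertices of the square complex. -/
def vertexSetoid (h : SquareSystem S) : Setoid {s : Word X // Reduced S s} where
  r s t := Homotopic S s.1 t.1
  iseqv := ⟨fun _ => .refl, Homotopic.symm h, Relation.ReflTransGen.trans⟩

/-- The vertices of the square complex. -/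
abbrev Vertex (h : SquareSystem S) : Type _ := Quotient h.vertexSetoid

/-- The neighbour of a vertex along the edge labelled `y`. -/
noncomputable def next [DecidableEq X] (h : SquareSystem S) (y : X × Bool) :
    h.Vertex → h.Vertex :=
  letI := h.vertexSetoid
  Quotient.map (fun s => ⟨mul S s.1 y, (h.isMul_mul s.1 y).reduced h s.2⟩)
    fun _ _ hst => (h.isMul_mul _ y).congr h (h.isMul_mul _ y) hst

/-- The vertex represented by a reduced word. -/
def vertex (h : SquareSystem S) (s : Word X) (hs : Reduced S s) : h.Vertex :=
  Quotient.mk h.vertexSetoid ⟨s, hs⟩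

theorem vertex_eq_iff (h : SquareSystem S) {s t : Word X} {hs : Reduced S s}
    {ht : Reduced S t} : h.vertex s hs = h.vertex t ht ↔ Homotopic S s t :=
  Quotient.eq

theorem next_vertex [DecidableEq X] (h : SquareSystem S) {s t : Word X} {y : X × Bool}
    (hs : Reduced S s) (hm : IsMul S s y t) :
    h.next y (h.vertex s hs) = h.vertex t (hm.reduced h hs) :=
  h.vertex_eq_iff.2 ((h.isMul_mul s y).congr h hm .refl)

theorem exists_vertex (h : SquareSystem S) (v : h.Vertex) : ∃ s hs, v = h.vertex s hs := by
  obtain ⟨⟨s, hs⟩, rfl⟩ := Quotient.exists_rep v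
  exact ⟨s, hs, rfl⟩

theorem next_letterInv_next [DecidableEq X] (h : SquareSystem S) (y : X × Bool)
    (v : h.Vertex) : h.next (letterInv y) (h.next y v) = v := by
  obtain ⟨s, hs, rfl⟩ := h.exists_vertex v
  have hm := h.isMul_mul s y
  rw [h.next_vertex hs hm, h.next_vertex _ (hm.symm h hs)]

theorem next_next_letterInv [DecidableEq X] (h : SquareSystem S) (y : X × Bool)
    (v : h.Vertex) : h.next y (h.next (letterInv y) v) = v := by
  simpa only [letterInv_letterInv] using h.next_letterInv_next (letterInv y) v

theorem next_next_eq [DecidableEq X] (h : SquareSystem S) {a b e f : X × Bool}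
    (hs : S a b e f) (v : h.Vertex) : h.next b (h.next a v) = h.next f (h.next e v) := by
  obtain ⟨s, hr, rfl⟩ := h.exists_vertex v
  obtain ⟨t, t', u, h1, h2, h3, h4⟩ := h.isMul_square s hs
  rw [h.next_vertex hr h1, h.next_vertex _ h2, h.next_vertex hr h3, h.next_vertex _ h4]

/-- The permutation of the vertices given by multiplication by a letter on the right. -/
noncomputable def nextPerm [DecidableEq X] (h : SquareSystem S) (y : X × Bool) :
    (Equiv.Perm h.Vertex)ᵐᵒᵖ :=
  .op ⟨h.next y, h.next (letterInv y), h.next_letterInv_next y, h.next_next_letterInv y⟩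

theorem nextPerm_letterInv [DecidableEq X] (h : SquareSystem S) (y : X × Bool) :
    h.nextPerm (letterInv y) = (h.nextPerm y)⁻¹ := by
  refine MulOpposite.unop_injective (Equiv.ext fun v => ?_)
  rfl

theorem prod_nextPerm_apply [DecidableEq X] (h : SquareSystem S) (w s : Word X)
    (hs : Reduced S s) : ∃ hr, (w.map h.nextPerm).prod.unop (h.vertex s hs) =
      h.vertex (w.foldl (mul S) s) hr := by
  induction w generalizing s with
  | nil => exact ⟨hs, rfl⟩
  | cons y w ih =>
    obtain ⟨hr, e⟩ := ih (mul S s y) ((h.isMul_mul s y).reduced h hs)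
    exact ⟨hr, e⟩

end SquareSystem

theorem lift_mk_eq_prod {X H : Type*} [Group H] (F : X × Bool → H)
    (hF : ∀ l, F (letterInv l) = (F l)⁻¹) (w : Word X) :
    FreeGroup.lift (fun x => F (x, true)) (FreeGroup.mk w) = (w.map F).prod := by
  rw [FreeGroup.lift_mk]
  congr 1
  refine List.map_congr_left fun l _ => ?_
  obtain ⟨x, _ | _⟩ := l
  · exact (hF (x, true)).symm
  · rfl

theorem toG_append {X : Type*} (R : Set (FreeGroup X)) (v w : Word X) :
    toG R (v ++ w) = toG R v * toG R w := by
  rw [toG, ← FreeGroup.mul_mk, map_mul]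
  rfl

theorem toG_cons {X : Type*} (R : Set (FreeGroup X)) (l : X × Bool) (w : Word X) :
    toG R (l :: w) = toG R [l] * toG R w :=
  toG_append R [l] w

theorem toG_nil {X : Type*} (R : Set (FreeGroup X)) : toG R [] = 1 :=
  map_one _

theorem toG_letterInv {X : Type*} (R : Set (FreeGroup X)) (l : X × Bool) :
    toG R [letterInv l] = (toG R [l])⁻¹ := by
  rw [toG, toG, ← map_inv, FreeGroup.inv_mk]
  rfl

theorem toG_eq_one_of_mem {X : Type*} {R : Set (FreeGroup X)} {w : Word X}
    (h : FreeGroup.mk w ∈ R) : toG R w = 1 :=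
  PresentedGroup.one_of_mem h

theorem toGroup_toG {X H : Type*} [Group H] {R : Set (FreeGroup X)} (F : X × Bool → H)
    (hF : ∀ l, F (letterInv l) = (F l)⁻¹)
    (hR : ∀ r ∈ R, FreeGroup.lift (fun x => F (x, true)) r = 1) (w : Word X) :
    PresentedGroup.toGroup hR (toG R w) = (w.map F).prod :=
  lift_mk_eq_prod F hF w

namespace SquareSystem

variable {X : Type*} {S : X × Bool → X × Bool → X × Bool → X × Bool → Prop}

theorem toG_mul [DecidableEq X] (h : SquareSystem S) {R : Set (FreeGroup X)}
    (hR : ∀ x a y b, S x a y b → toG R [x, a] = toG R [y, b]) (s : Word X) (y : X × Bool) :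
    toG R (mul S s y).reverse = toG R s.reverse * toG R [y] := by
  have hcross : ∀ {s t}, Cross S s t → toG R s.reverse = toG R t.reverse := by
    intro s t hc
    induction hc with
    | head p hs => simpa [toG_append] using hR _ _ _ _ hs
    | cons z _ ih => simp [toG_append, ih]
  have hhom : ∀ {s t}, Homotopic S s t → toG R s.reverse = toG R t.reverse := by
    intro s t hc
    induction hc with
    | refl => rfl
    | tail _ hc ih => rw [ih, hcross hc]
  rcases h.isMul_mul s y with ⟨-, ht⟩ | ⟨-, ht⟩
  · simp [hhom ht, toG_append]
  · simp [hhom ht, toG_append, toG_letterInv]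

theorem toG_foldl_mul [DecidableEq X] (h : SquareSystem S) {R : Set (FreeGroup X)}
    (hR : ∀ x a y b, S x a y b → toG R [x, a] = toG R [y, b]) (w s : Word X) :
    toG R (w.foldl (mul S) s).reverse = toG R s.reverse * toG R w := by
  induction w generalizing s with
  | nil => simp [toG_nil]
  | cons y w ih => rw [List.foldl_cons, ih, h.toG_mul hR, toG_cons R y w, mul_assoc]

theorem foldl_mul_eq_nil_iff [DecidableEq X] (h : SquareSystem S) {R : Set (FreeGroup X)}
    (hR : ∀ r, r ∈ R ↔ ∃ a b c d, S a b (letterInv d) (letterInv c) ∧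
      r = FreeGroup.mk [a, b, c, d]) (w : Word X) :
    w.foldl (mul S) [] = [] ↔ toG R w = 1 := by
  constructor
  · intro hw
    have := h.toG_foldl_mul (R := R) ?_ w []
    · simpa [hw, toG_nil] using this.symm
    intro x a y b hs
    have hr : toG R [x, a, letterInv b, letterInv y] = 1 :=
      toG_eq_one_of_mem ((hR _).2 ⟨x, a, _, _, by simpa only [letterInv_letterInv], rfl⟩)
    rw [toG_cons R x, toG_cons R a, toG_cons R (letterInv b), toG_letterInv,
      toG_letterInv] at hr
    rw [toG_cons R x, toG_cons R y, ← mul_inv_eq_one, mul_inv_rev, ← hr, mul_assoc]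
  · intro hw
    have hrel : ∀ r ∈ R, FreeGroup.lift (fun x => h.nextPerm (x, true)) r = 1 := by
      intro r hr
      obtain ⟨a, b, c, d, hs, rfl⟩ := (hR r).1 hr
      rw [lift_mk_eq_prod _ h.nextPerm_letterInv]
      refine MulOpposite.unop_injective (Equiv.ext fun v => ?_)
      change h.next d (h.next c (h.next b (h.next a v))) = v
      rw [h.next_next_eq hs, h.next_next_letterInv, h.next_next_letterInv]
    obtain ⟨hr, e⟩ := h.prod_nextPerm_apply w [] trivial
    rw [← toGroup_toG _ h.nextPerm_letterInv hrel, hw, map_one] at e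
    have := (h.vertex_eq_iff.1 e).length_eq
    exact List.eq_nil_of_length_eq_zero this.symm

theorem primrec_cancel [DecidableEq X] [Primcodable X] [Finite X]
    (S : X × Bool → X × Bool → X × Bool → X × Bool → Prop) : Primrec₂ (cancel S) := by
  have : Fintype X := Fintype.ofFinite X
  let L : List (X × Bool) := Finset.univ.toList
  have hL : ∀ l, l ∈ L := by simp [L]
  -- the table of all values of `cancel S s` at letters
  have htable : Primrec fun s : Word X => L.map (cancel S s) := by
    let step : (X × Bool) × Word X × List (Option (Word X)) → List (Option (Word X)) := fun q =>
      L.map fun y => if y = letterInv q.1 then some q.2.1 else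
        (opposite S q.1 y).bind fun r => (q.2.2[L.idxOf r.1]?.getD none).map (r.2 :: ·)
    have hstep : Primrec step := by
      refine Primrec.list_map (.const L) (Primrec.ite ?_ ?_ ?_)
      · exact Primrec.eq.comp .snd ((Primrec.dom_finite letterInv).comp (Primrec.fst.comp .fst))
      · exact Primrec.option_some.comp (Primrec.fst.comp (Primrec.snd.comp .fst))
      · refine Primrec.option_bind ?_ (Primrec.option_map ?_ ?_)
        · exact (Primrec.dom_finite fun q : (X × Bool) × (X × Bool) => opposite S q.1 q.2).comp
            (Primrec.pair (Primrec.fst.comp .fst) .snd)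
        · refine Primrec.option_getD.comp (Primrec.list_getElem?.comp ?_ ?_) (.const none)
          · exact Primrec.snd.comp (Primrec.snd.comp (Primrec.fst.comp .fst))
          · exact (Primrec.dom_finite fun l => L.idxOf l).comp (Primrec.fst.comp .snd)
        · exact Primrec.list_cons.comp (Primrec.snd.comp (Primrec.snd.comp .fst)) .snd
    refine (Primrec.list_rec .id (.const (L.map fun _ => none))
      (hstep.comp .snd).to₂).of_eq fun s => ?_
    induction s with
    | nil => rfl
    | cons z p ih =>
      simp only [id] at ih ⊢
      simp only [ih, step, cancel]
      refine List.map_congr_left fun y _ => ?_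
      have hidx : ∀ x, (L.map (cancel S p))[L.idxOf x]?.getD none = cancel S p x := fun x => by
        rw [List.getElem?_map, List.getElem?_idxOf (hL x)]
        rfl
      simp only [hidx]
  refine (Primrec.option_getD.comp (Primrec.list_getElem?.comp (htable.comp .fst)
    ((Primrec.dom_finite fun l => L.idxOf l).comp .snd)) (.const none)).of_eq fun q => ?_
  rw [List.getElem?_map, List.getElem?_idxOf (hL q.2)]
  rfl

theorem primrec_mul [DecidableEq X] [Primcodable X] [Finite X]
    (S : X × Bool → X × Bool → X × Bool → X × Bool → Prop) : Primrec₂ (mul S) :=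
  Primrec.option_getD.comp (primrec_cancel S) (Primrec.list_cons.comp .snd .fst)

theorem wordProblem [DecidableEq X] [Primcodable X] [Finite X] (h : SquareSystem S)
    {R : Set (FreeGroup X)} (hR : ∀ r, r ∈ R ↔ ∃ a b c d, S a b (letterInv d) (letterInv c) ∧
      r = FreeGroup.mk [a, b, c, d]) :
    ∃ f : Word X → Bool, Computable f ∧ ∀ w, f w = true ↔ toG R w = 1 := by
  refine ⟨fun w => decide (w.foldl (mul S) [] = []), Primrec.to_comp ?_, fun w => ?_⟩
  · have hm : Primrec₂ fun (_ : Word X) (q : Word X × (X × Bool)) => mul S q.1 q.2 :=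
      (primrec_mul S).comp (Primrec.fst.comp .snd) (Primrec.snd.comp .snd)
    exact (Primrec.eq.comp (Primrec.list_foldl .id (.const []) hm)
      (.const ([] : Word X))).decide
  · rw [decide_eq_true_iff, h.foldl_mul_eq_nil_iff hR]

end SquareSystem

/-- The letter `a` starts at most one relator, so it is not a piece. -/
def NonPiece {X : Type*} (Q : X × Bool → X × Bool → X × Bool → X × Bool → Prop)
    (a : X × Bool) : Prop :=
  ∀ b c d b' c' d', Q a b c d → Q a b' c' d' → b = b' ∧ c = c' ∧ d = d'

/-- The set of words `a b c d` with `Q a b c d` is symmetrized, satisfies the link form of T(4)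
and, whenever two relators share a prefix of length two, each has a non-piece among its last two
letters. -/
structure SquareRelators {X : Type*}
    (Q : X × Bool → X × Bool → X × Bool → X × Bool → Prop) : Prop where
  rot : ∀ {a b c d}, Q a b c d → Q b c d a
  inv : ∀ {a b c d}, Q a b c d → Q (letterInv d) (letterInv c) (letterInv b) (letterInv a)
  red : ∀ {a b c d}, Q a b c d → b ≠ letterInv a
  triangle : ∀ {x y z a b c d e f}, Q (letterInv x) y a b → Q (letterInv y) z c d →
    Q (letterInv z) x e f → False
  nonPiece : ∀ {x y a b c d}, Q x y a b → Q x y c d → ¬ (a = c ∧ b = d) →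
    NonPiece Q a ∨ NonPiece Q b

/-- The relators encoded by `Q`. -/
def relatorSet {X : Type*} (Q : X × Bool → X × Bool → X × Bool → X × Bool → Prop) :
    Set (FreeGroup X) :=
  {r | ∃ a b c d, Q a b c d ∧ r = FreeGroup.mk [a, b, c, d]}

namespace SquareRelators

variable {X : Type*} {Q : X × Bool → X × Bool → X × Bool → X × Bool → Prop}

theorem squareSystem (h : SquareRelators Q)
    (hu : ∀ {x y a b c d}, Q x y a b → Q x y c d → a = c ∧ b = d) :
    SquareSystem fun x a y b => Q x a (letterInv b) (letterInv y) where
  symm hs := by simpa only [letterInv_letterInv] using h.rot (h.rot (h.inv (h.rot (h.rot hs))))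
  turn hs := by
    simpa only [letterInv_letterInv] using h.rot (h.rot (h.rot (h.inv hs)))
  ne hs := by
    rintro rfl
    exact h.red (h.rot (h.rot (h.rot hs))) (letterInv_letterInv _).symm
  triangle h1 h2 h3 :=
    h.triangle (h.rot (h.rot (h.rot h1))) (h.rot (h.rot (h.rot h3))) (h.rot (h.rot (h.rot h2)))
  unique h1 h2 := by
    obtain ⟨e1, e2⟩ := hu h1 h2
    exact ⟨letterInv_injective e2, letterInv_injective e1⟩

theorem not_nonPiece_of_eq_letterInv (h : SquareRelators Q) {n e g : X × Bool}
    (hn : NonPiece Q n) (hq : Q n e (letterInv n) g) : False := by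
  have hq' := h.rot (h.inv hq)
  rw [letterInv_letterInv] at hq'
  exact letterInv_ne e (hn _ _ _ _ _ _ hq hq').1.symm

/-- If some relator is not determined by its first two letters, some letter occurs exactly once in
exactly one relator up to rotation and inversion. -/
theorem exists_isolated (h : SquareRelators Q) {x y a b c d : X × Bool}
    (hq : Q x y a b) (hq' : Q x y c d) (hne : ¬ (a = c ∧ b = d)) :
    ∃ n e f g, Q n e f g ∧ NonPiece Q n ∧ e.1 ≠ n.1 ∧ f.1 ≠ n.1 ∧ g.1 ≠ n.1 := by
  have hx : ¬ NonPiece Q x := fun hn => hne (hn _ _ _ _ _ _ hq hq').2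
  have hy : ¬ NonPiece Q y := fun hn => by
    obtain ⟨e1, e2, -⟩ := hn _ _ _ _ _ _ (h.rot hq) (h.rot hq')
    exact hne ⟨e1, e2⟩
  have key : ∀ {n e f g}, Q n e f g → NonPiece Q n → n ≠ f → n ≠ e → n ≠ g →
      ∃ n e f g, Q n e f g ∧ NonPiece Q n ∧ e.1 ≠ n.1 ∧ f.1 ≠ n.1 ∧ g.1 ≠ n.1 := by
    intro n e f g hq hn h1 h2 h3
    refine ⟨n, e, f, g, hq, hn, fun he => ?_, fun hf => ?_, fun hg => ?_⟩
    · rcases eq_or_eq_letterInv he with rfl | rfl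
      · exact h2 rfl
      · exact h.red hq rfl
    · rcases eq_or_eq_letterInv hf with rfl | rfl
      · exact h1 rfl
      · exact h.not_nonPiece_of_eq_letterInv hn hq
    · rcases eq_or_eq_letterInv hg with rfl | rfl
      · exact h3 rfl
      · exact h.red (h.rot (h.rot (h.rot hq))) (letterInv_letterInv n).symm
  have hab : a = b → ¬ NonPiece Q a := by
    rintro rfl hn
    obtain ⟨e2, -, -⟩ := hn _ _ _ _ _ _ (h.rot (h.rot hq)) (h.rot (h.rot (h.rot hq)))
    exact hx (e2 ▸ hn)
  rcases h.nonPiece hq hq' hne with hn | hn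
  · refine key (h.rot (h.rot hq)) hn ?_ ?_ ?_
    · rintro rfl
      exact hx hn
    · exact fun e => hab e hn
    · rintro rfl
      exact hy hn
  · refine key (h.rot (h.rot (h.rot hq))) hn ?_ ?_ ?_
    · rintro rfl
      exact hy hn
    · rintro rfl
      exact hx hn
    · rintro rfl
      exact hab rfl hn

/-- The relators avoiding a generator. -/
def Avoiding (Q : X × Bool → X × Bool → X × Bool → X × Bool → Prop) (x : X)
    (a b c d : X × Bool) : Prop :=
  Q a b c d ∧ a.1 ≠ x ∧ b.1 ≠ x ∧ c.1 ≠ x ∧ d.1 ≠ x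

theorem avoiding (h : SquareRelators Q) (x : X) : SquareRelators (Avoiding Q x) where
  rot := fun ⟨hq, ha, hb, hc, hd⟩ => ⟨h.rot hq, hb, hc, hd, ha⟩
  inv := fun ⟨hq, ha, hb, hc, hd⟩ => ⟨h.inv hq, hd, hc, hb, ha⟩
  red hq := h.red hq.1
  triangle h1 h2 h3 := h.triangle h1.1 h2.1 h3.1
  nonPiece h1 h2 hne :=
    (h.nonPiece h1.1 h2.1 hne).imp
      (fun hn _ _ _ _ _ _ k1 k2 => hn _ _ _ _ _ _ k1.1 k2.1)
      (fun hn _ _ _ _ _ _ k1 k2 => hn _ _ _ _ _ _ k1.1 k2.1)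

/-- Replacing the letter `n` by `(e f g)⁻¹`. -/
def eliminate [DecidableEq X] (n e f g l : X × Bool) : Word X :=
  if l = n then [letterInv g, letterInv f, letterInv e]
  else if l = letterInv n then [e, f, g] else [l]

theorem toG_eliminate_letterInv [DecidableEq X] (R : Set (FreeGroup X)) (n e f g l : X × Bool) :
    toG R (eliminate n e f g (letterInv l)) = (toG R (eliminate n e f g l))⁻¹ := by
  have hR : toG R [letterInv g, letterInv f, letterInv e] = (toG R [e, f, g])⁻¹ := by
    rw [toG_cons R (letterInv g), toG_cons R (letterInv f), toG_cons R e, toG_cons R f,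
      toG_letterInv, toG_letterInv, toG_letterInv]
    group
  unfold eliminate
  by_cases h1 : l = n
  · subst h1
    rw [if_neg (letterInv_ne l), if_pos rfl, if_pos rfl, hR, inv_inv]
  by_cases h2 : l = letterInv n
  · subst h2
    rw [letterInv_letterInv, if_pos rfl, if_neg (letterInv_ne n), if_pos rfl, hR]
  · have h3 : letterInv l ≠ n := fun e => h2 (by rw [← e, letterInv_letterInv])
    have h4 : letterInv l ≠ letterInv n := fun e => h1 (letterInv_injective e)
    rw [if_neg h1, if_neg h2, if_neg h3, if_neg h4, toG_letterInv]

theorem eliminate_of_ne [DecidableEq X] {n l : X × Bool} (e f g : X × Bool)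
    (h : l.1 ≠ n.1) : eliminate n e f g l = [l] := by
  have h1 : l ≠ n := fun k => h (congrArg Prod.fst k)
  have h2 : l ≠ letterInv n := fun k => h (by rw [k, letterInv])
  rw [eliminate, if_neg h1, if_neg h2]

theorem toG_flatMap {Y : Type*} (R : Set (FreeGroup X)) (F : Y → Word X) (w : List Y) :
    toG R (w.flatMap F) = (w.map fun l => toG R (F l)).prod := by
  induction w with
  | nil => exact toG_nil R
  | cons l w ih => rw [List.flatMap_cons, toG_append, ih, List.map_cons, List.prod_cons]

theorem toG_eq_prod (R : Set (FreeGroup X)) (w : Word X) :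
    toG R w = (w.map fun l => toG R [l]).prod := by
  rw [← toG_flatMap R (fun l => [l]), List.flatMap_singleton']

theorem toG_flatMap_eliminate [DecidableEq X] {n e f g : X × Bool} (hq : Q n e f g)
    (w : Word X) : toG (relatorSet Q) (w.flatMap (eliminate n e f g)) = toG (relatorSet Q) w := by
  rw [toG_flatMap, toG_eq_prod _ w]
  congr 1
  refine List.map_congr_left fun l _ => ?_
  have hrel : toG (relatorSet Q) [n] = (toG (relatorSet Q) [e, f, g])⁻¹ := by
    rw [eq_inv_iff_mul_eq_one, ← toG_cons]
    exact toG_eq_one_of_mem ⟨n, e, f, g, hq, rfl⟩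
  have hn : toG (relatorSet Q) (eliminate n e f g n) = toG (relatorSet Q) [n] := by
    rw [← inv_inj, ← toG_eliminate_letterInv, eliminate, if_neg (letterInv_ne n), if_pos rfl, hrel,
      inv_inv]
  by_cases h1 : l.1 = n.1
  · rcases eq_or_eq_letterInv h1 with rfl | rfl
    · exact hn
    · rw [toG_eliminate_letterInv, hn, toG_letterInv]
  · rw [eliminate_of_ne e f g h1]

theorem toG_eliminate_eq_one [DecidableEq X] (h : SquareRelators Q) {n e f g : X × Bool}
    (hq : Q n e f g) (hn : NonPiece Q n) (he : e.1 ≠ n.1) (hf : f.1 ≠ n.1) (hg : g.1 ≠ n.1)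
    {w : Word X} (hw : toG (relatorSet Q) w = 1) :
    toG (relatorSet (Avoiding Q n.1)) (w.flatMap (eliminate n e f g)) = 1 := by
  set R := relatorSet (Avoiding Q n.1)
  let F : X × Bool → PresentedGroup R := fun l => toG R (eliminate n e f g l)
  have hF : ∀ l, F (letterInv l) = (F l)⁻¹ := toG_eliminate_letterInv R n e f g
  have hF1 : ∀ {l}, l.1 ≠ n.1 → F l = toG R [l] := fun hl => by
    simp only [F, eliminate_of_ne e f g hl]
  have hbase : F n * F e * F f * F g = 1 := by
    have : (F n)⁻¹ = toG R [e, f, g] := by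
      rw [← hF]
      simp only [F, eliminate, if_neg (letterInv_ne n), if_true]
    rw [hF1 he, hF1 hf, hF1 hg, ← inv_inv (F n), this, toG_cons R e, toG_cons R f]
    group
  have hrot : ∀ {a b c d}, F b * F c * F d * F a = 1 → F a * F b * F c * F d = 1 := by
    intro a b c d k
    rw [mul_eq_one_iff_eq_inv] at k
    rw [mul_assoc, mul_assoc, ← mul_assoc (F b), k, mul_inv_cancel]
  have hfirst : ∀ {a b c d}, a.1 = n.1 → Q a b c d → F a * F b * F c * F d = 1 := by
    intro a b c d ha k
    rcases eq_or_eq_letterInv ha with rfl | rfl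
    · obtain ⟨rfl, rfl, rfl⟩ := hn _ _ _ _ _ _ hq k
      exact hbase
    · have k' := h.rot (h.rot (h.rot (h.inv k)))
      rw [letterInv_letterInv] at k'
      obtain ⟨rfl, rfl, rfl⟩ := hn _ _ _ _ _ _ hq k'
      refine hrot ?_
      rw [hF, ← inv_eq_one, ← hbase, hF, hF, hF]
      group
  have hrel : ∀ r ∈ relatorSet Q, FreeGroup.lift (fun x => F (x, true)) r = 1 := by
    rintro r ⟨a, b, c, d, k, rfl⟩
    rw [lift_mk_eq_prod F hF]
    have : F a * F b * F c * F d = 1 := by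
      by_cases ha : a.1 = n.1
      · exact hfirst ha k
      by_cases hb : b.1 = n.1
      · exact hrot (hfirst hb (h.rot k))
      by_cases hc : c.1 = n.1
      · exact hrot (hrot (hfirst hc (h.rot (h.rot k))))
      by_cases hd : d.1 = n.1
      · exact hrot (hrot (hrot (hfirst hd (h.rot (h.rot (h.rot k))))))
      rw [hF1 ha, hF1 hb, hF1 hc, hF1 hd, ← toG_append, ← toG_append, ← toG_append]
      exact toG_eq_one_of_mem ⟨a, b, c, d, ⟨k, ha, hb, hc, hd⟩, rfl⟩
    simpa [mul_assoc] using this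
  rw [toG_flatMap, ← toGroup_toG F hF hrel, hw, map_one]

theorem wordProblem [DecidableEq X] [Primcodable X] [Finite X] (h : SquareRelators Q) :
    ∃ f : Word X → Bool, Computable f ∧ ∀ w, f w = true ↔ toG (relatorSet Q) w = 1 := by
  let count (Q : X × Bool → X × Bool → X × Bool → X × Bool → Prop) : ℕ :=
    {q : (X × Bool) × (X × Bool) × (X × Bool) × (X × Bool) | Q q.1 q.2.1 q.2.2.1 q.2.2.2}.ncard
  induction hk : count Q using Nat.strong_induction_on generalizing Q with
  | _ k ih =>
  by_cases hu : ∀ x y a b c d, Q x y a b → Q x y c d → a = c ∧ b = d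
  · refine (h.squareSystem fun {x y a b c d} => hu x y a b c d).wordProblem fun r => ?_
    simp only [letterInv_letterInv]
    rfl
  · push Not at hu
    obtain ⟨x, y, a, b, c, d, hq, hq', hne⟩ := hu
    obtain ⟨n, e, f, g, hq, hn, he, hf, hg⟩ := h.exists_isolated hq hq' fun k => hne k.1 k.2
    have hlt : count (Avoiding Q n.1) < k := by
      rw [← hk]
      refine Set.ncard_lt_ncard ⟨fun q k => k.1, fun hsub => ?_⟩ (Set.toFinite _)
      exact (hsub (a := (n, e, f, g)) hq).2.1 rfl
    obtain ⟨F, hF, hFw⟩ := ih _ hlt (h.avoiding n.1) rfl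
    refine ⟨fun w => F (w.flatMap (eliminate n e f g)), hF.comp ?_, fun w => ?_⟩
    · exact (Primrec.list_flatMap .id
        ((Primrec.dom_finite (eliminate n e f g)).comp .snd).to₂).to_comp
    · rw [hFw]
      refine ⟨fun hw => ?_, h.toG_eliminate_eq_one hq hn he hf hg⟩
      rw [← toG_flatMap_eliminate hq]
      refine PresentedGroup.mk_eq_one_iff.2 (Subgroup.normalClosure_mono ?_
        (PresentedGroup.mk_eq_one_iff.1 hw))
      rintro r ⟨a, b, c, d, k, rfl⟩
      exact ⟨a, b, c, d, k.1, rfl⟩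

end SquareRelators

theorem isPiece_of_not_nonPiece {X : Type*} [DecidableEq X] {R : Set (FreeGroup X)}
    {a : X × Bool}
    (h : ¬ NonPiece (fun a b c d => ∃ r ∈ R, r.toWord = [a, b, c, d]) a) : IsPiece R [a] := by
  simp only [NonPiece, not_forall] at h
  obtain ⟨b, c, d, b', c', d', ⟨r, hr, hrw⟩, ⟨s, hs, hsw⟩, hne⟩ := h
  refine ⟨by simp, r, hr, s, hs, ?_, ⟨_, hrw⟩, ⟨_, hsw⟩⟩
  rintro rfl
  rw [hrw] at hsw
  simp_all

theorem not_noCancel {X : Type*} [DecidableEq X] {r s : FreeGroup X} {a b c d e f x : X × Bool}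
    (hr : r.toWord = [a, b, c, letterInv x]) (hs : s.toWord = [x, d, e, f]) :
    ¬ NoCancel r s := by
  intro h
  have hred : FreeGroup.IsReduced (r * s).toWord := FreeGroup.isReduced_toWord
  rw [h, hr, hs] at hred
  simp [FreeGroup.IsReduced, letterInv] at hred

theorem Symmetrized.squareRelators {X : Type*} [DecidableEq X] {R : Set (FreeGroup X)}
    (hsym : Symmetrized R) (hC : Cpp4 R) (hT : T4 R) :
    SquareRelators fun a b c d => ∃ r ∈ R, r.toWord = [a, b, c, d] := by
  have rot : ∀ {a b c d : X × Bool}, (∃ r ∈ R, r.toWord = [a, b, c, d]) →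
      ∃ r ∈ R, r.toWord = [b, c, d, a] := by
    rintro a b c d ⟨r, hr, hw⟩
    have hmem := hsym.2.2 r hr a [b, c, d] hw
    have hlen := hC.1 _ hmem
    refine ⟨_, hmem, ?_⟩
    rw [FreeGroup.toWord_mk] at hlen ⊢
    exact (FreeGroup.reduce.red.sublist).eq_of_length hlen
  have red : ∀ {a b c d : X × Bool}, (∃ r ∈ R, r.toWord = [a, b, c, d]) → b ≠ letterInv a := by
    rintro a b c d ⟨r, hr, hw⟩ rfl
    have hred : FreeGroup.IsReduced r.toWord := FreeGroup.isReduced_toWord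
    rw [hw] at hred
    simp [FreeGroup.IsReduced, letterInv] at hred
  refine ⟨rot, ?_, red, ?_, ?_⟩
  · rintro a b c d ⟨r, hr, hw⟩
    refine ⟨r⁻¹, hsym.2.1 r hr, ?_⟩
    rw [FreeGroup.toWord_inv, hw]
    rfl
  · intro x y z a b c d e f h1 h2 h3
    obtain ⟨r₁, hr₁, hw₁⟩ := rot h1
    obtain ⟨r₂, hr₂, hw₂⟩ := rot h2
    obtain ⟨r₃, hr₃, hw₃⟩ := rot h3
    have hne : ∀ {r s : FreeGroup X} {a b c d e f g h : X × Bool}, r.toWord = [a, b, c, d] →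
        s.toWord = [e, f, g, h] → a ≠ letterInv h → r ≠ s⁻¹ := by
      rintro r s a b c d e f g h hr hs hah rfl
      rw [FreeGroup.toWord_inv, hs] at hr
      exact hah (List.cons.inj hr).1.symm
    have hyz : z ≠ y := fun e => red h2 (by rw [e, letterInv_letterInv])
    have hxy : y ≠ x := fun e => red h1 (by rw [e, letterInv_letterInv])
    have hzx : x ≠ z := fun e => red h3 (by rw [e, letterInv_letterInv])
    rcases hT r₃ hr₃ r₂ hr₂ r₁ hr₁
      (hne hw₃ hw₂ (by rw [letterInv_letterInv]; exact hxy.symm))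
      (hne hw₂ hw₁ (by rw [letterInv_letterInv]; exact hzx.symm))
      (fun e => hne hw₁ hw₃ (by rw [letterInv_letterInv]; exact hyz.symm) (by rw [e, inv_inv]))
      with h | h | h
    · exact not_noCancel hw₃ hw₂ h
    · exact not_noCancel hw₂ hw₁ h
    · exact not_noCancel hw₁ hw₃ h
  · rintro x y a b c d ⟨r, hr, hrw⟩ ⟨s, hs, hsw⟩ hne
    by_contra! hcon
    have hrs : r ≠ s := by
      rintro rfl
      rw [hrw] at hsw
      simp_all
    refine hC.2 r hr ⟨[[x, y], [a], [b]], by simp, ?_, hrw⟩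
    simp only [List.mem_cons, List.not_mem_nil, or_false, forall_eq_or_imp, forall_eq]
    exact ⟨⟨by simp, r, hr, s, hs, hrs, ⟨_, hrw⟩, ⟨_, hsw⟩⟩, isPiece_of_not_nonPiece hcon.1,
      isPiece_of_not_nonPiece hcon.2⟩

theorem relatorSet_toWord {X : Type*} [DecidableEq X] {R : Set (FreeGroup X)}
    (hR : ∀ r ∈ R, r.toWord.length = 4) :
    relatorSet (fun a b c d => ∃ r ∈ R, r.toWord = [a, b, c, d]) = R := by
  ext r
  constructor
  · rintro ⟨a, b, c, d, ⟨s, hs, hw⟩, rfl⟩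
    rwa [← hw, FreeGroup.mk_toWord]
  · intro hr
    obtain ⟨a, b, c, d, hw⟩ := List.length_eq_four.1 (hR r hr)
    exact ⟨a, b, c, d, ⟨r, hr, hw⟩, by rw [← hw, FreeGroup.mk_toWord]⟩

/-- The word problem for a group given by a finite symmetrized C''(4)–T(4) presentation
over a finite alphabet (with decidable equality) is decidable: there is a computable
function deciding whether a word represents the identity. -/
theorem wordProblem_decidable {m : ℕ} (R : Finset (FreeGroup (Fin m)))
    (hsym : Symmetrized (R : Set (FreeGroup (Fin m))))
    (hC : Cpp4 (R : Set (FreeGroup (Fin m))))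
    (hT : T4 (R : Set (FreeGroup (Fin m)))) :
    ∃ f : Word (Fin m) → Bool, Computable f ∧
      ∀ w : Word (Fin m), f w = true ↔ toG (R : Set (FreeGroup (Fin m))) w = 1 := by
  have h := (hsym.squareRelators hC hT).wordProblem
  rwa [relatorSet_toWord hC.1] at h
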